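/- Let (Γ_q, i_q) be a Bourgain–Delbaen system on Γ with constant C, and let Γ' be a self-determined subset of Γ. Then (Γ'_{q_s}, i'_{q_s})_{s≥0} is itself a Bourgain–Delbaen system on Γ': each i'_{q_s} is an extension operator (i'_{q_s}(x)(γ) = x(γ) for γ ∈ Γ'_{q_s}), sup_s ‖i'_{q_s}‖ ≤ C, and the operators are compatible: for s < t and x ∈ ℓ∞(Γ'_{q_s}), i'_{q_s}(x) = i'_{q_t}(r'_{q_t}(i'_{q_s}(x))). -/

import Mathlib

noncomputable section
open scoped ENNReal

/-- `ℓ∞(Γ)`. -/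
abbrev Linfty (Γ : Type) := lp (fun _ : Γ => ℝ) ∞

/-- The evaluation functional `f ↦ f γ` on `ℓ∞(Γ)`. -/
def evalLinfty {Γ : Type} (γ : Γ) : Linfty Γ →L[ℝ] ℝ :=
  LinearMap.mkContinuous
    { toFun := fun f => f γ
      map_add' := fun f g => by simp [lp.coeFn_add]
      map_smul' := fun c f => by simp [lp.coeFn_smul] }
    1 (fun f => by
      rw [one_mul]
      exact lp.norm_apply_le_norm ENNReal.top_ne_zero f γ)

/-- The restriction operator `r_s : ℓ∞(Γ) → ℓ∞(s)` for a finite subset `s` of `Γ`;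
the target carries the sup norm. -/
def restrFin {Γ : Type} (s : Finset Γ) : Linfty Γ →L[ℝ] (↥s → ℝ) :=
  LinearMap.mkContinuous
    { toFun := fun f γ => f (γ : Γ)
      map_add' := fun f g => by funext γ; simp [lp.coeFn_add]
      map_smul' := fun c f => by funext γ; simp [lp.coeFn_smul] }
    1 (fun f => by
      rw [one_mul]
      refine (pi_norm_le_iff_of_nonneg (norm_nonneg f)).mpr ?_
      intro γ
      exact lp.norm_apply_le_norm ENNReal.top_ne_zero f (γ : Γ))

/-- A Bourgain–Delbaen system on a set `Γ`: a strictly increasing sequence of finite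
subsets of `Γ` with union `Γ`, together with a uniformly bounded compatible sequence of
extension operators.  We use the convention `Gam 0 = ∅`, so that for `q ≥ 1` the set
`Gam q` is the set `Γ_q` of the paper (all of them nonempty, by strict monotonicity). -/
structure BDSystem (Γ : Type) where
  Gam : ℕ → Finset Γ
  Gam_zero : Gam 0 = ∅
  mono : StrictMono Gam
  exhaustive : ∀ γ : Γ, ∃ q, γ ∈ Gam q
  i : ∀ q : ℕ, (↥(Gam q) → ℝ) →L[ℝ] Linfty Γ
  isExtension : ∀ (q : ℕ) (x : ↥(Gam q) → ℝ) (γ : ↥(Gam q)), (i q x) (γ : Γ) = x γ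
  compatible : ∀ p q : ℕ, p < q → ∀ x : ↥(Gam p) → ℝ,
      i p x = i q (fun γ : ↥(Gam q) => (i p x) (γ : Γ))
  normBound : ℝ
  norm_i_le : ∀ q, ‖i q‖ ≤ normBound

namespace BDSystem

variable {Γ : Type} (S : BDSystem Γ)

/-- The constant `C = sup_q ‖i_q‖` of the system. -/
def const : ℝ := ⨆ q, ‖S.i q‖

/-- The rank of `γ`: the unique `q` with `γ ∈ Δ_q = Γ_q ∖ Γ_{q-1}`, i.e. the least `q`
with `γ ∈ Γ_q`. -/
def rank (γ : Γ) : ℕ := @Nat.find _ (Classical.decPred _) (S.exhaustive γ)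

/-- The vector `d_γ = i_q (e_γ) ∈ ℓ∞(Γ)`, where `q = rank γ`. -/
def dvec (γ : Γ) : Linfty Γ :=
  S.i (S.rank γ) (fun η => @ite _ ((η : Γ) = γ) (Classical.dec _) 1 0)

/-- The Bourgain–Delbaen space `X`, the closed linear span of `{d_γ : γ ∈ Γ}`,
as a closed submodule of `ℓ∞(Γ)`. -/
def X : Submodule ℝ (Linfty Γ) :=
  (Submodule.span ℝ (Set.range S.dvec)).topologicalClosure

theorem dvec_mem_X (γ : Γ) : S.dvec γ ∈ S.X :=
  (Submodule.span ℝ (Set.range S.dvec)).le_topologicalClosure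
    (Submodule.subset_span (Set.mem_range_self γ))

/-- `d_γ` as an element of the space `X`. -/
def dX (γ : Γ) : ↥S.X := ⟨S.dvec γ, S.dvec_mem_X γ⟩

/-- The evaluation functional `e_γ^* ∈ X^*`. -/
def evalX (γ : Γ) : StrongDual ℝ ↥S.X :=
  (evalLinfty γ).comp S.X.subtypeL

/-- The cumulative projection `P_{[1,q]}`: the restriction to `X` of `i_q ∘ r_q`
(with values in `ℓ∞(Γ)`).  Note that `P_{[1,0]} = 0`, since `Gam 0 = ∅`. -/
def P (q : ℕ) : ↥S.X →L[ℝ] Linfty Γ :=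
  ((S.i q).comp (restrFin (S.Gam q))).comp S.X.subtypeL

/-- `P_{[1,q]}` for `q ∈ ℕ ∪ {∞}`, where `P_{[1,∞]}` is the inclusion of `X` into `ℓ∞(Γ)`. -/
def Pcum : ℕ∞ → (↥S.X →L[ℝ] Linfty Γ)
  | (q : ℕ) => S.P q
  | ⊤ => S.X.subtypeL

/-- The projection `P_E` associated to the interval `E = (p, q]` of `ℕ` (`q = ⊤` allowed). -/
def PE (p : ℕ) (q : ℕ∞) : ↥S.X →L[ℝ] Linfty Γ := S.Pcum q - S.P p

/-- The functional `d_γ^* = e_γ^* ∘ P_{(rank γ − 1, rank γ]}`, biorthogonal to `d_γ`. -/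
def dstar (γ : Γ) : StrongDual ℝ ↥S.X :=
  (evalLinfty γ).comp (S.PE (S.rank γ - 1) (S.rank γ))

/-- The functional `c_γ^* = e_γ^* − d_γ^*`. -/
def cstar (γ : Γ) : StrongDual ℝ ↥S.X := S.evalX γ - S.dstar γ

/-- A subset `Γ'` of `Γ` is self-determined if it is infinite and for every `γ ∈ Γ'` the
functional `d_γ^*` lies in the linear span of `{e_η^* : η ∈ Γ'}` in `X^*`. -/
def SelfDetermined (Γ' : Set Γ) : Prop :=
  Γ'.Infinite ∧ ∀ γ ∈ Γ', S.dstar γ ∈ Submodule.span ℝ (S.evalX '' Γ')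

end BDSystem

/-- The restriction operator `R : ℓ∞(Γ) → ℓ∞(Γ')` for a subset `Γ'` of `Γ`. -/
def restrSet {Γ : Type} (Γ' : Set Γ) : Linfty Γ →L[ℝ] Linfty ↥Γ' :=
  LinearMap.mkContinuous
    { toFun := fun f => ⟨fun γ => f (γ : Γ), memℓp_infty ⟨‖f‖, by
        rintro x ⟨γ, rfl⟩
        exact lp.norm_apply_le_norm ENNReal.top_ne_zero f (γ : Γ)⟩⟩
      map_add' := fun f g => by ext γ; simp [lp.coeFn_add]; rfl
      map_smul' := fun c f => by ext γ; simp [lp.coeFn_smul] }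
    1 (fun f => by
      rw [one_mul]
      refine lp.norm_le_of_forall_le (norm_nonneg f) ?_
      intro γ
      exact lp.norm_apply_le_norm ENNReal.top_ne_zero f (γ : Γ))

/-- The finite subset `Γ' ∩ s` of `Γ'`, for a finite subset `s` of `Γ`. -/
def subFin {Γ : Type} (Γ' : Set Γ) (s : Finset Γ) : Finset ↥Γ' :=
  letI := Classical.decPred (· ∈ Γ'); s.subtype (· ∈ Γ')

theorem mem_subFin {Γ : Type} {Γ' : Set Γ} {s : Finset Γ} {x : ↥Γ'} :
    x ∈ subFin Γ' s ↔ (x : Γ) ∈ s := by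
  letI := Classical.decPred (· ∈ Γ')
  simp [subFin, Finset.mem_subtype]

/-- Extension by zero, from functions on `Γ' ∩ s` to functions on `s`. -/
def extZero {Γ : Type} (Γ' : Set Γ) (s : Finset Γ) :
    (↥(subFin Γ' s) → ℝ) →L[ℝ] (↥s → ℝ) :=
  LinearMap.toContinuousLinearMap
    { toFun := fun x η =>
        @dite _ ((η : Γ) ∈ Γ') (Classical.dec _)
          (fun h => x ⟨⟨η, h⟩, mem_subFin.mpr η.2⟩) (fun _ => 0)
      map_add' := fun x y => by
        funext η
        by_cases h : (η : Γ) ∈ Γ'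
        · simp only [Pi.add_apply, dif_pos h]
        · simp only [Pi.add_apply, dif_neg h, add_zero]
      map_smul' := fun c x => by
        funext η
        by_cases h : (η : Γ) ∈ Γ'
        · simp only [Pi.smul_apply, dif_pos h, RingHom.id_apply, smul_eq_mul]
        · simp only [Pi.smul_apply, dif_neg h, RingHom.id_apply, smul_eq_mul, mul_zero] }

/-- Restriction of a function on `s` to a function on `Γ' ∩ s`. -/
def resSub {Γ : Type} (Γ' : Set Γ) (s : Finset Γ) (x : ↥s → ℝ) : ↥(subFin Γ' s) → ℝ :=
  fun η => x ⟨(η : Γ), mem_subFin.mp η.2⟩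

namespace BDSystem

variable {Γ : Type} (S : BDSystem Γ)

/-- The induced extension operator `i'_q : ℓ∞(Γ' ∩ Γ_q) → ℓ∞(Γ')`, defined by
`i'_q(x) = R (i_q (x̃))`, where `x̃` is the extension of `x` by zero. -/
def iInd (Γ' : Set Γ) (q : ℕ) : (↥(subFin Γ' (S.Gam q)) → ℝ) →L[ℝ] Linfty ↥Γ' :=
  ((restrSet Γ').comp (S.i q)).comp (extZero Γ' (S.Gam q))

end BDSystem

namespace BDSystem

variable {Γ : Type} (S : BDSystem Γ)

theorem mem_rank (γ : Γ) : γ ∈ S.Gam (S.rank γ) := by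
  classical
  unfold rank
  exact @Nat.find_spec _ (Classical.decPred _) (S.exhaustive γ)

theorem rank_le {γ : Γ} {q : ℕ} (h : γ ∈ S.Gam q) : S.rank γ ≤ q := by
  unfold rank
  exact @Nat.find_min' _ (Classical.decPred _) (S.exhaustive γ) q h

theorem i_mem_X (q : ℕ) : ∀ x : ↥(S.Gam q) → ℝ, S.i q x ∈ S.X := by
  classical
  induction q with
  | zero =>
    intro x
    have hx : x = 0 := by
      funext γ
      have h : ∀ g : Γ, g ∉ S.Gam 0 := by
        intro g
        rw [S.Gam_zero]
        exact Finset.notMem_empty g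
      exact absurd γ.2 (h γ)
    rw [hx, map_zero]
    exact S.X.zero_mem
  | succ q ih =>
    intro x
    have hsub : S.Gam q ⊆ S.Gam (q+1) := S.mono.monotone (Nat.le_succ q)
    set u : ↥(S.Gam q) → ℝ := fun γ => x ⟨γ, hsub γ.2⟩ with hu
    set y : ↥(S.Gam (q+1)) → ℝ := fun γ => (S.i q u) (γ : Γ) with hy
    have h1 : S.i (q+1) y ∈ S.X := by
      rw [hy, ← S.compatible q (q+1) (Nat.lt_succ_self q) u]
      exact ih u
    have h2 : S.i (q+1) (x - y) ∈ S.X := by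
      have hsum : x - y = ∑ γ : ↥(S.Gam (q+1)), (x - y) γ • (Pi.single γ (1:ℝ)) := by
        exact pi_eq_sum_univ' (x - y)
      rw [hsum, map_sum]
      refine S.X.sum_mem fun γ _ => ?_
      rw [map_smul]
      by_cases hγ : (γ : Γ) ∈ S.Gam q
      · have : (x - y) γ = 0 := by
          have := S.isExtension q u ⟨γ, hγ⟩
          simp only [Pi.sub_apply, hy]
          rw [sub_eq_zero]
          exact this.symm
        rw [this, zero_smul]
        exact S.X.zero_mem
      · refine S.X.smul_mem _ ?_
        have hr : S.rank (γ : Γ) = q + 1 := by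
          refine le_antisymm (S.rank_le γ.2) ?_
          by_contra hlt
          exact hγ (S.mono.monotone (by omega : S.rank (γ : Γ) ≤ q) (S.mem_rank (γ : Γ)))
        have hd := S.dvec_mem_X (γ : Γ)
        unfold dvec at hd
        rw [hr] at hd
        convert hd using 2
        funext j
        rw [Pi.single_apply]
        by_cases hj : j = γ
        · rw [if_pos hj, if_pos (congrArg Subtype.val hj)]
        · rw [if_neg hj, if_neg (fun h => hj (Subtype.ext h))]
    have := S.X.add_mem h2 h1
    rwa [← map_add, sub_add_cancel] at this

theorem compat_le {p q : ℕ} (h : p ≤ q) (x : ↥(S.Gam p) → ℝ) :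
    S.i q (fun γ : ↥(S.Gam q) => (S.i p x) (γ : Γ)) = S.i p x := by
  rcases h.lt_or_eq with h | rfl
  · exact (S.compatible p q h x).symm
  · congr 1
    funext γ
    exact S.isExtension p x γ

theorem span_local (Γ' : Set Γ) (φ : StrongDual ℝ ↥S.X)
    (hφ : φ ∈ Submodule.span ℝ (S.evalX '' Γ')) :
    ∃ N, ∀ M, N ≤ M → ∀ u v : ↥S.X,
      (∀ η ∈ Γ', η ∈ S.Gam M → (u : Linfty Γ) η = (v : Linfty Γ) η) → φ u = φ v := by
  induction hφ using Submodule.span_induction with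
  | mem φ h =>
    obtain ⟨η, hη, rfl⟩ := h
    obtain ⟨N, hN⟩ := S.exhaustive η
    exact ⟨N, fun M hM u v h => h η hη (S.mono.monotone hM hN)⟩
  | zero => exact ⟨0, fun M _ u v _ => rfl⟩
  | add φ ψ _ _ h1 h2 =>
    obtain ⟨N1, h1⟩ := h1
    obtain ⟨N2, h2⟩ := h2
    refine ⟨max N1 N2, fun M hM u v h => ?_⟩
    have a := h1 M (le_trans (le_max_left _ _) hM) u v h
    have b := h2 M (le_trans (le_max_right _ _) hM) u v h
    simp [a, b]
  | smul c φ _ h1 =>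
    obtain ⟨N1, h1⟩ := h1
    refine ⟨N1, fun M hM u v h => ?_⟩
    simp [h1 M hM u v h]

theorem dstar_apply (γ : Γ) (n : ℕ) (hn : S.rank γ = n) (u : ↥S.X) :
    S.dstar γ u = (S.i n (fun η => (u : Linfty Γ) (η : Γ))) γ
      - (S.i (n - 1) (fun η => (u : Linfty Γ) (η : Γ))) γ := by
  subst hn
  change (evalLinfty γ) (_ - _) = _
  rw [map_sub]
  rfl

theorem vanish (Γ' : Set Γ) (hsd : S.SelfDetermined Γ') (q : ℕ) (w : ↥(S.Gam q) → ℝ)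
    (hw : ∀ γ : ↥(S.Gam q), (γ : Γ) ∈ Γ' → w γ = 0) :
    ∀ n, ∀ γ ∈ Γ', S.rank γ = n → (S.i q w) γ = 0 := by
  classical
  intro n
  induction n using Nat.strong_induction_on with
  | _ n ih =>
    intro γ hγ hn
    by_cases hq : n ≤ q
    · have hm : γ ∈ S.Gam q := S.mono.monotone hq (hn ▸ S.mem_rank γ)
      rw [S.isExtension q w ⟨γ, hm⟩]
      exact hw _ hγ
    · push Not at hq
      obtain ⟨N, hN⟩ := S.span_local Γ' _ (hsd.2 γ hγ)
      set M := max N n with hM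
      set y : ↥(S.Gam M) → ℝ := fun η => if (η : Γ) ∈ Γ' then (S.i q w) (η : Γ) else 0 with hy
      have hyy : ∀ η ∈ S.Gam M, (S.i M y) η = if η ∈ Γ' then (S.i q w) η else 0 :=
        fun η hη => S.isExtension M y ⟨η, hη⟩
      have key := hN M (le_max_left _ _) ⟨S.i q w, S.i_mem_X q w⟩ ⟨S.i M y, S.i_mem_X M y⟩
        (fun η hη hηM => by simp [hyy η hηM, hη])
      rw [S.dstar_apply γ n hn, S.dstar_apply γ n hn] at key
      rw [S.compat_le hq.le, S.compat_le (by omega : q ≤ n - 1), sub_self] at key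
      have e1 := S.isExtension n (fun η => (S.i M y) (η : Γ)) ⟨γ, hn ▸ S.mem_rank γ⟩
      have hz : (fun η : ↥(S.Gam (n-1)) => (S.i M y) (η : Γ)) = 0 := by
        funext η
        have hηM : (η : Γ) ∈ S.Gam M :=
          S.mono.monotone (le_trans (Nat.sub_le n 1) (le_max_right _ _)) η.2
        rw [hyy _ hηM]
        split_ifs with hη
        · have := S.rank_le η.2
          exact ih (S.rank η) (by omega) η hη rfl
        · rfl
      have hγM : γ ∈ S.Gam M := S.mono.monotone (le_max_right _ _) (hn ▸ S.mem_rank γ)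
      simp only at e1
      rw [hz, map_zero, e1, hyy γ hγM, if_pos hγ] at key
      simpa using key.symm

theorem iInd_apply (Γ' : Set Γ) (q : ℕ) (x : ↥(subFin Γ' (S.Gam q)) → ℝ) (γ : ↥Γ') :
    (S.iInd Γ' q x) γ = (S.i q (extZero Γ' (S.Gam q) x)) (γ : Γ) := rfl

end BDSystem

theorem extZero_apply_mem {Γ : Type} (Γ' : Set Γ) (s : Finset Γ) (x : ↥(subFin Γ' s) → ℝ)
    (η : ↥s) (h : (η : Γ) ∈ Γ') :
    extZero Γ' s x η = x ⟨⟨η, h⟩, mem_subFin.mpr η.2⟩ :=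
  dif_pos h

theorem extZero_apply_not_mem {Γ : Type} (Γ' : Set Γ) (s : Finset Γ)
    (x : ↥(subFin Γ' s) → ℝ) (η : ↥s) (h : (η : Γ) ∉ Γ') :
    extZero Γ' s x η = 0 :=
  dif_neg h

theorem norm_extZero_le {Γ : Type} (Γ' : Set Γ) (s : Finset Γ) (x : ↥(subFin Γ' s) → ℝ) :
    ‖extZero Γ' s x‖ ≤ ‖x‖ := by
  refine (pi_norm_le_iff_of_nonneg (norm_nonneg x)).mpr fun η => ?_
  by_cases h : (η : Γ) ∈ Γ'
  · rw [extZero_apply_mem _ _ _ _ h]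
    exact norm_le_pi_norm x _
  · rw [extZero_apply_not_mem _ _ _ _ h, norm_zero]
    exact norm_nonneg x

/-- If `Γ'` is a self-determined subset of `Γ`, then the induced family
`(Γ'_{q_s}, i'_{q_s})` is itself a Bourgain–Delbaen system on `Γ'`: each `i'_{q_s}` is an
extension operator, `sup_s ‖i'_{q_s}‖ ≤ C`, and the operators are compatible. -/
theorem induced_is_BDSystem {Γ : Type} (S : BDSystem Γ) (Γ' : Set Γ)
    (hsd : S.SelfDetermined Γ') (qs : ℕ → ℕ) (hqs : StrictMono qs)
    (hrange : ∀ q : ℕ, (∃ γ ∈ Γ', S.rank γ = q) ↔ ∃ s, qs s = q) :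
    (∀ (s : ℕ) (x : ↥(subFin Γ' (S.Gam (qs s))) → ℝ) (η : ↥(subFin Γ' (S.Gam (qs s)))),
      (S.iInd Γ' (qs s) x) ((η : ↥Γ')) = x η) ∧
    (∀ s : ℕ, ‖S.iInd Γ' (qs s)‖ ≤ S.const) ∧
    (∀ s t : ℕ, s < t → ∀ x : ↥(subFin Γ' (S.Gam (qs s))) → ℝ,
      S.iInd Γ' (qs s) x =
        S.iInd Γ' (qs t) (fun η : ↥(subFin Γ' (S.Gam (qs t))) =>
          (S.iInd Γ' (qs s) x) ((η : ↥Γ')))) := by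
  have hext : ∀ (s : ℕ) (x : ↥(subFin Γ' (S.Gam (qs s))) → ℝ)
      (η : ↥(subFin Γ' (S.Gam (qs s)))), (S.iInd Γ' (qs s) x) ((η : ↥Γ')) = x η := by
    intro s x η
    rw [S.iInd_apply, S.isExtension (qs s) _ ⟨(η : ↥Γ'), mem_subFin.mp η.2⟩,
      extZero_apply_mem _ _ _ _ (η : ↥Γ').2]
  refine ⟨hext, ?_, ?_⟩
  · intro s
    have hC : ‖S.i (qs s)‖ ≤ S.const :=
      le_ciSup (f := fun q => ‖S.i q‖)
        ⟨S.normBound, by rintro _ ⟨q, rfl⟩; exact S.norm_i_le q⟩ (qs s)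
    have hC0 : 0 ≤ S.const := (norm_nonneg _).trans hC
    refine ContinuousLinearMap.opNorm_le_bound _ hC0 fun x => ?_
    refine lp.norm_le_of_forall_le (by positivity) fun γ => ?_
    rw [S.iInd_apply]
    calc _ ≤ ‖S.i (qs s) (extZero Γ' (S.Gam (qs s)) x)‖ :=
          lp.norm_apply_le_norm ENNReal.top_ne_zero _ _
      _ ≤ ‖S.i (qs s)‖ * ‖extZero Γ' (S.Gam (qs s)) x‖ := ContinuousLinearMap.le_opNorm _ _
      _ ≤ S.const * ‖x‖ := by
          gcongr
          exact norm_extZero_le _ _ _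
  · intro s t hst x
    ext γ
    rw [S.iInd_apply, S.iInd_apply,
      ← S.compat_le (hqs hst).le (extZero Γ' (S.Gam (qs s)) x), ← sub_eq_zero,
      ← Pi.sub_apply, ← lp.coeFn_sub, ← map_sub]
    refine S.vanish Γ' hsd _ _ (fun η hη => ?_) _ γ γ.2 rfl
    rw [Pi.sub_apply, extZero_apply_mem _ _ _ _ hη, S.iInd_apply, sub_self]
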